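/- Let G be the parallel composition of multigraphs G1 and G2 at distinct vertices a and b, let s ∈ V1 \ {a, b}, let t ∈ V2 \ {a, b}, and let r_a, r_s, r_t, r_b ∈ ℤ with r_a + r_s + r_t + r_b = 0. Then mincost(G, [a ↦ r_a, s ↦ r_s, t ↦ r_t, b ↦ r_b]) = ⨅_{r ∈ ℤ} ( mincost(G1, [a ↦ r, s ↦ r_s, b ↦ −r − r_s]) + mincost(G2, [a ↦ r_a − r, t ↦ r_t, b ↦ r_b + r_s + r]) ), where the infimum and addition are in ℕ∞. -/

import Mathlib

open scoped BigOperators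

/-- An undirected multigraph on vertex type `V` with edge type `E`:
each edge has a reference orientation `src e → tgt e`, a cost `c e` and a capacity `u e`. -/
structure Multigraph (V E : Type) where
  src : E → V
  tgt : E → V
  c : E → ℕ
  u : E → ℕ

variable {V E : Type}

/-- The residue of a flow assignment `f : E → ℤ` at a vertex `v`:
inflow (w.r.t. the reference orientation) minus outflow. -/
def Multigraph.residue [Fintype E] [DecidableEq V] (G : Multigraph V E)
    (f : E → ℤ) (v : V) : ℤ :=
  (∑ e : E, if G.tgt e = v then f e else 0) - (∑ e : E, if G.src e = v then f e else 0)

/-- `f` is an `r`-circulation supported on `F`: it vanishes outside `F`,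
respects capacities, and has residue `r v` at every vertex `v`. -/
def Multigraph.IsCirculation [Fintype E] [DecidableEq V] (G : Multigraph V E)
    (r : V → ℤ) (F : Finset E) (f : E → ℤ) : Prop :=
  (∀ e, e ∉ F → f e = 0) ∧ (∀ e, |f e| ≤ (G.u e : ℤ)) ∧ (∀ v, G.residue f v = r v)

/-- The minimum cost (in `ℕ∞`) of a subset `F` of the allowed edge set `E'`
admitting an `r`-circulation supported on `F`.  Taking `E' = Finset.univ`
gives `mincost(G, r)`; taking `E' = E₁` for a sub-multigraph `(V₁, E₁)` all of
whose edges have both endpoints in `V₁` gives `mincost(G₁, r)` whenever `r`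
vanishes outside `V₁`. -/
noncomputable def Multigraph.mincostOn [Fintype E] [DecidableEq V] (G : Multigraph V E)
    (E' : Finset E) (r : V → ℤ) : ℕ∞ :=
  ⨅ (F : Finset E) (_ : F ⊆ E' ∧ ∃ f : E → ℤ, G.IsCirculation r F f),
    ((∑ e ∈ F, G.c e : ℕ) : ℕ∞)

namespace Multigraph

variable [Fintype E] [DecidableEq V]

lemma residue_add (G : Multigraph V E) (f g : E → ℤ) (v : V) :
    G.residue (f + g) v = G.residue f v + G.residue g v := by
  simp only [residue, ← Finset.sum_filter, Pi.add_apply, Finset.sum_add_distrib]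
  ring

lemma sum_residue [Fintype V] (G : Multigraph V E) (f : E → ℤ) :
    ∑ v, G.residue f v = 0 := by
  simp only [residue, Finset.sum_sub_distrib]
  rw [Finset.sum_comm, Finset.sum_comm (f := fun v e => if G.src e = v then f e else 0)]
  simp

lemma residue_eq_zero (G : Multigraph V E) {f : E → ℤ} {E' : Finset E} {V' : Finset V}
    (hf : ∀ e, e ∉ E' → f e = 0) (hG : ∀ e ∈ E', G.src e ∈ V' ∧ G.tgt e ∈ V')
    {v : V} (hv : v ∉ V') : G.residue f v = 0 := by
  have key : ∀ e, G.src e = v ∨ G.tgt e = v → f e = 0 := by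
    rintro e h
    refine hf e fun he => hv ?_
    rcases h with rfl | rfl
    exacts [(hG e he).1, (hG e he).2]
  rw [residue, Finset.sum_eq_zero, Finset.sum_eq_zero, sub_zero]
  · exact fun e _ => ite_eq_right_iff.2 fun h => key e (.inl h)
  · exact fun e _ => ite_eq_right_iff.2 fun h => key e (.inr h)

/-- A residue function vanishing outside three vertices is determined by two of its values. -/
lemma residue_eq_neg_sub [Fintype V] (G : Multigraph V E) (f : E → ℤ) {x y z : V}
    (hxy : x ≠ y) (hxz : x ≠ z) (hyz : y ≠ z)
    (h : ∀ v, v ≠ x → v ≠ y → v ≠ z → G.residue f v = 0) :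
    G.residue f z = -G.residue f x - G.residue f y := by
  have hsum := G.sum_residue f
  rw [← Finset.sum_subset (Finset.subset_univ {x, y, z}) (by
    intro v _ hv
    simp only [Finset.mem_insert, Finset.mem_singleton, not_or] at hv
    exact h v hv.1 hv.2.1 hv.2.2), Finset.sum_insert (by simp [hxy, hxz]),
    Finset.sum_pair hyz] at hsum
  linarith

lemma IsCirculation.union [DecidableEq E] {G : Multigraph V E} {r₁ r₂ : V → ℤ}
    {F₁ F₂ : Finset E} {f₁ f₂ : E → ℤ} (h₁ : G.IsCirculation r₁ F₁ f₁)
    (h₂ : G.IsCirculation r₂ F₂ f₂) (hF : Disjoint F₁ F₂) :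
    G.IsCirculation (r₁ + r₂) (F₁ ∪ F₂) (f₁ + f₂) := by
  refine ⟨fun e he => ?_, fun e => ?_, fun v => ?_⟩
  · rw [Finset.mem_union, not_or] at he
    simp [h₁.1 e he.1, h₂.1 e he.2]
  · by_cases he : e ∈ F₁
    · simpa [h₂.1 e (Finset.disjoint_left.1 hF he)] using h₁.2.1 e
    · simpa [h₁.1 e he] using h₂.2.1 e
  · rw [residue_add, h₁.2.2, h₂.2.2, Pi.add_apply]

/-- The restriction of a circulation to an edge set is supported on that set. -/
lemma IsCirculation.restrict [DecidableEq E] {G : Multigraph V E} {r r' : V → ℤ}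
    {F : Finset E} {f : E → ℤ} (h : G.IsCirculation r F f) (E' : Finset E)
    (hr : ∀ v, G.residue (fun e => if e ∈ E' then f e else 0) v = r' v) :
    G.IsCirculation r' (F ∩ E') (fun e => if e ∈ E' then f e else 0) := by
  refine ⟨fun e he => ?_, fun e => ?_, hr⟩
  · dsimp only
    split_ifs with h'
    · exact h.1 e fun h'' => he (Finset.mem_inter.2 ⟨h'', h'⟩)
    · rfl
  · dsimp only
    split_ifs
    · exact h.2.1 e
    · simp

lemma mincostOn_le {G : Multigraph V E} {E' F : Finset E} {r : V → ℤ} {f : E → ℤ}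
    (hF : F ⊆ E') (hf : G.IsCirculation r F f) :
    G.mincostOn E' r ≤ ((∑ e ∈ F, G.c e : ℕ) : ℕ∞) :=
  iInf₂_le F ⟨hF, f, hf⟩

lemma exists_mincostOn_eq {G : Multigraph V E} {E' : Finset E} {r : V → ℤ}
    (h : G.mincostOn E' r ≠ ⊤) :
    ∃ F ⊆ E', (∃ f, G.IsCirculation r F f) ∧
      G.mincostOn E' r = ((∑ e ∈ F, G.c e : ℕ) : ℕ∞) := by
  obtain ⟨F, hF⟩ := ciInf_mem fun F : Finset E =>
    ⨅ _ : F ⊆ E' ∧ ∃ f : E → ℤ, G.IsCirculation r F f, ((∑ e ∈ F, G.c e : ℕ) : ℕ∞)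
  change _ = G.mincostOn E' r at hF
  by_cases hp : F ⊆ E' ∧ ∃ f : E → ℤ, G.IsCirculation r F f
  · exact ⟨F, hp.1, hp.2, by simpa [hp] using hF.symm⟩
  · exact absurd (by simpa only [hp, iInf_false] using hF.symm) h

end Multigraph

/-- Case 3.5: parallel composition with `s` and `t` in different parallel components. -/
theorem parallel_four_tuple_diff_components {V E : Type}
    [Fintype V] [Fintype E] [DecidableEq V] [DecidableEq E]
    (G : Multigraph V E) (V1 V2 : Finset V) (E1 E2 : Finset E)
    (hE : E1 ∪ E2 = Finset.univ) (hEdisj : Disjoint E1 E2)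
    (hV : V1 ∪ V2 = Finset.univ)
    (hG1 : ∀ e ∈ E1, G.src e ∈ V1 ∧ G.tgt e ∈ V1)
    (hG2 : ∀ e ∈ E2, G.src e ∈ V2 ∧ G.tgt e ∈ V2)
    (a b s t : V) (hab : a ≠ b) (hVab : V1 ∩ V2 = {a, b})
    (hs : s ∈ V1) (hsa : s ≠ a) (hsb : s ≠ b)
    (ht : t ∈ V2) (hta : t ≠ a) (htb : t ≠ b)
    (ra rs rt rb : ℤ) (hsum : ra + rs + rt + rb = 0) :
    G.mincostOn Finset.univ
        (fun v => if v = a then ra else if v = s then rs else if v = t then rt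
          else if v = b then rb else 0) =
      ⨅ r : ℤ,
        G.mincostOn E1
          (fun v => if v = a then r else if v = s then rs else if v = b then -r - rs else 0) +
        G.mincostOn E2
          (fun v => if v = a then ra - r else if v = t then rt
            else if v = b then rb + rs + r else 0) := by
  have hmem : ∀ v, v ∈ V1 → v ∈ V2 → v = a ∨ v = b := fun v h1 h2 => by
    simpa [hVab] using Finset.mem_inter.2 ⟨h1, h2⟩
  have hs2 : s ∉ V2 := fun h => (hmem s hs h).elim hsa hsb
  have ht1 : t ∉ V1 := fun h => (hmem t h ht).elim hta htb
  have hst : s ≠ t := fun h => ht1 (h ▸ hs)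
  apply le_antisymm
  · refine le_iInf fun r => ?_
    by_cases h1 : G.mincostOn E1
        (fun v => if v = a then r else if v = s then rs else if v = b then -r - rs else 0) = ⊤
    · simp [h1]
    by_cases h2 : G.mincostOn E2
        (fun v => if v = a then ra - r else if v = t then rt
          else if v = b then rb + rs + r else 0) = ⊤
    · simp [h2]
    obtain ⟨F₁, hF₁, ⟨f₁, hf₁⟩, e₁⟩ := Multigraph.exists_mincostOn_eq h1
    obtain ⟨F₂, hF₂, ⟨f₂, hf₂⟩, e₂⟩ := Multigraph.exists_mincostOn_eq h2
    have hF : Disjoint F₁ F₂ := hEdisj.mono hF₁ hF₂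
    rw [e₁, e₂, ← Nat.cast_add, ← Finset.sum_union hF]
    refine Multigraph.mincostOn_le (Finset.subset_univ _) (f := f₁ + f₂) ?_
    convert hf₁.union hf₂ hF using 1
    funext v
    simp only [Pi.add_apply]
    grind
  · refine le_iInf₂ ?_
    rintro F ⟨-, f, hf⟩
    set f₁ : E → ℤ := fun e => if e ∈ E1 then f e else 0 with hf₁
    set f₂ : E → ℤ := fun e => if e ∈ E2 then f e else 0 with hf₂
    have hcover : ∀ e, e ∈ E1 ∨ e ∈ E2 := fun e => by
      simpa [hE] using Finset.mem_union (s := E1) (t := E2) (a := e)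
    have hadd : f = f₁ + f₂ := by
      funext e
      rcases hcover e with he | he
      · simp [hf₁, hf₂, he, Finset.disjoint_left.1 hEdisj he]
      · simp [hf₁, hf₂, he, Finset.disjoint_right.1 hEdisj he]
    have hres : ∀ v, G.residue f₁ v + G.residue f₂ v = if v = a then ra
        else if v = s then rs else if v = t then rt else if v = b then rb else 0 := fun v => by
      rw [← Multigraph.residue_add, ← hadd]
      exact hf.2.2 v
    have hz₁ : ∀ v, v ∉ V1 → G.residue f₁ v = 0 := fun v =>
      G.residue_eq_zero (fun e he => if_neg he) hG1
    have hz₂ : ∀ v, v ∉ V2 → G.residue f₂ v = 0 := fun v =>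
      G.residue_eq_zero (fun e he => if_neg he) hG2
    have hVcover : ∀ v, v ∈ V1 ∨ v ∈ V2 := fun v => by
      simpa [hV] using Finset.mem_union (s := V1) (t := V2) (a := v)
    have hb₁ := G.residue_eq_neg_sub f₁ hsa.symm hab hsb fun v h1 h2 h3 => by
      grind
    have hr₁ : ∀ v, G.residue f₁ v = if v = a then G.residue f₁ a else if v = s then rs
        else if v = b then -G.residue f₁ a - rs else 0 := by
      grind
    have hr₂ : ∀ v, G.residue f₂ v = if v = a then ra - G.residue f₁ a else if v = t then rt
        else if v = b then rb + rs + G.residue f₁ a else 0 := by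
      grind
    have hcost : ∑ e ∈ F, G.c e = ∑ e ∈ F ∩ E1, G.c e + ∑ e ∈ F ∩ E2, G.c e := by
      rw [← Finset.sum_union (hEdisj.mono Finset.inter_subset_right Finset.inter_subset_right),
        ← Finset.inter_union_distrib_left, hE, Finset.inter_univ]
    rw [hcost, Nat.cast_add]
    exact (iInf_le _ (G.residue f₁ a)).trans <| add_le_add
      (Multigraph.mincostOn_le Finset.inter_subset_right (hf.restrict E1 hr₁))
      (Multigraph.mincostOn_le Finset.inter_subset_right (hf.restrict E2 hr₂))
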